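/- Let S ⊆ B(H) and T ⊆ B(K) be norm-closed self-adjoint subspaces with I_H ∈ S, I_K ∈ T (concrete operator systems), and suppose M ⊆ B(H,K) is a ternary ring of operators with T equal to the norm-closed span of M S M* and S equal to the norm-closed span of M* T M. Then I_H lies in the norm-closed span of M*M and I_K lies in the norm-closed span of MM* (i.e. M is automatically nondegenerate in this algebraic span sense). -/

import Mathlib

open ContinuousLinearMap

/-- A bounded operator with coercive real part is, after rescaling, at distance less than one from
the identity. -/
theorem exists_norm_one_sub_smul_lt_one {F : Type*} [NormedAddCommGroup F]
    [InnerProductSpace ℂ F] {a : F →L[ℂ] F} {δ : ℝ} (hδ : 0 < δ)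
    (h : ∀ x, δ * ‖x‖ ^ 2 ≤ (inner ℂ (a x) x).re) : ∃ c : ℂ, ‖1 - c • a‖ < 1 := by
  set B := ‖a‖ ^ 2 + δ ^ 2
  have hB0 : 0 < B := by positivity
  refine ⟨((δ / B : ℝ) : ℂ), ?_⟩
  have hq : 0 ≤ 1 - δ ^ 2 / B := by
    rw [sub_nonneg, div_le_one hB0]
    nlinarith [sq_nonneg ‖a‖]
  have hbound : ‖1 - ((δ / B : ℝ) : ℂ) • a‖ ≤ √(1 - δ ^ 2 / B) := by
    refine opNorm_le_bound _ (Real.sqrt_nonneg _) fun x => ?_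
    refine le_of_sq_le_sq ?_ (by positivity)
    rw [mul_pow, Real.sq_sqrt hq, sub_apply, one_apply_eq_self, smul_apply, @norm_sub_sq ℂ,
      inner_smul_right, norm_smul, Complex.norm_real, mul_pow, Real.norm_eq_abs, sq_abs]
    have h₁ := h x
    rw [← inner_conj_symm, Complex.conj_re] at h₁
    have h₂ : ‖a x‖ ^ 2 ≤ B * ‖x‖ ^ 2 := by
      have := pow_le_pow_left₀ (norm_nonneg _) (le_opNorm a x) 2
      rw [mul_pow] at this
      nlinarith [mul_nonneg (sq_nonneg δ) (sq_nonneg ‖x‖)]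
    have h₃ : (δ / B) * (δ * ‖x‖ ^ 2) ≤ (δ / B) * (inner ℂ x (a x)).re := by gcongr
    have h₄ : (δ / B) ^ 2 * ‖a x‖ ^ 2 ≤ (δ / B) ^ 2 * (B * ‖x‖ ^ 2) := by gcongr
    have h₅ : (δ / B) ^ 2 * (B * ‖x‖ ^ 2) = (δ / B) * (δ * ‖x‖ ^ 2) := by field_simp
    have h₆ : (1 - δ ^ 2 / B) * ‖x‖ ^ 2 = ‖x‖ ^ 2 - (δ / B) * (δ * ‖x‖ ^ 2) := by ring
    rw [h₆, RCLike.re_eq_complex_re, Complex.re_ofReal_mul]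
    linarith
  refine hbound.trans_lt ?_
  rw [Real.sqrt_lt' one_pos]
  have : 0 < δ ^ 2 / B := by positivity
  linarith

section TernaryRing

variable {E F : Type*} [NormedAddCommGroup E] [InnerProductSpace ℂ E] [CompleteSpace E]
  [NormedAddCommGroup F] [InnerProductSpace ℂ F] [CompleteSpace F]

/-- The linear span of `M M*` for a ternary ring of operators `M` is closed under composition. -/
theorem span_comp_adjoint_mul_mem {M : Set (E →L[ℂ] F)}
    (hM : ∀ x ∈ M, ∀ y ∈ M, ∀ z ∈ M, x ∘L (adjoint y ∘L z) ∈ M) {a b : F →L[ℂ] F}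
    (ha : a ∈ Submodule.span ℂ {x | ∃ m ∈ M, ∃ n ∈ M, x = m ∘L adjoint n})
    (hb : b ∈ Submodule.span ℂ {x | ∃ m ∈ M, ∃ n ∈ M, x = m ∘L adjoint n}) :
    a * b ∈ Submodule.span ℂ {x | ∃ m ∈ M, ∃ n ∈ M, x = m ∘L adjoint n} := by
  induction ha, hb using Submodule.span_induction₂ with
  | mem_mem x y hx hy =>
    obtain ⟨m, hm, n, hn, rfl⟩ := hx
    obtain ⟨p, hp, q, hq, rfl⟩ := hy
    exact Submodule.subset_span ⟨_, hM m hm n hn p hp, q, hq, rfl⟩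
  | zero_left => simp
  | zero_right => simp
  | add_left x y z _ _ _ h₁ h₂ => rw [add_mul]; exact add_mem h₁ h₂
  | add_right x y z _ _ _ h₁ h₂ => rw [mul_add]; exact add_mem h₁ h₂
  | smul_left r x y _ _ h => rw [smul_mul_assoc]; exact Submodule.smul_mem _ r h
  | smul_right r x y _ _ h => rw [mul_smul_comm]; exact Submodule.smul_mem _ r h

/-- An element `t` of the right ideal generated by `M` satisfies `t t* ≤ C a` for some positive
`a` in the span of `M M*`. -/
theorem exists_norm_adjoint_sq_le_of_mem_span {M : Set (E →L[ℂ] F)} {t : F →L[ℂ] F}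
    (ht : t ∈ Submodule.span ℂ {x | ∃ m ∈ M, ∃ b : F →L[ℂ] E, x = m ∘L b}) :
    ∃ a ∈ Submodule.span ℂ {x | ∃ m ∈ M, ∃ n ∈ M, x = m ∘L adjoint n}, ∃ C : ℝ, 0 ≤ C ∧
      ∀ x, 0 ≤ (inner ℂ (a x) x).re ∧ ‖adjoint t x‖ ^ 2 ≤ C * (inner ℂ (a x) x).re := by
  induction ht using Submodule.span_induction with
  | mem t ht =>
    obtain ⟨m, hm, b, rfl⟩ := ht
    refine ⟨m ∘L adjoint m, Submodule.subset_span ⟨m, hm, m, hm, rfl⟩, ‖adjoint b‖ ^ 2,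
      by positivity, fun x => ?_⟩
    have h : (inner ℂ ((m ∘L adjoint m) x) x).re = ‖adjoint m x‖ ^ 2 := by
      rw [comp_apply, ← adjoint_inner_right, inner_self_eq_norm_sq_to_K]
      norm_cast
    rw [h, adjoint_comp, comp_apply, ← mul_pow]
    exact ⟨by positivity, by gcongr; exact le_opNorm _ _⟩
  | zero => exact ⟨0, zero_mem _, 0, le_rfl, fun x => by simp⟩
  | add t u _ _ iht ihu =>
    obtain ⟨a, ha, C, hC, h⟩ := iht
    obtain ⟨b, hb, D, hD, k⟩ := ihu
    refine ⟨a + b, add_mem ha hb, 2 * (C + D), by positivity, fun x => ?_⟩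
    obtain ⟨h₁, h₂⟩ := h x
    obtain ⟨k₁, k₂⟩ := k x
    rw [map_add, add_apply, add_apply, inner_add_left, Complex.add_re]
    refine ⟨by positivity, ?_⟩
    have hn := pow_le_pow_left₀ (norm_nonneg _) (norm_add_le (adjoint t x) (adjoint u x)) 2
    nlinarith [sq_nonneg (‖adjoint t x‖ - ‖adjoint u x‖), mul_nonneg hC k₁, mul_nonneg hD h₁]
  | smul c t _ ih =>
    obtain ⟨a, ha, C, hC, h⟩ := ih
    refine ⟨a, ha, ‖c‖ ^ 2 * C, by positivity, fun x => ⟨(h x).1, ?_⟩⟩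
    rw [map_smulₛₗ, smul_apply, norm_smul, RCLike.norm_conj, mul_pow, mul_assoc]
    gcongr
    exact (h x).2

/-- If the closed right ideal generated by a ternary ring of operators `M` contains the identity,
then so does the closed span of `M M*`. -/
theorem id_mem_closure_span_comp_adjoint {M : Set (E →L[ℂ] F)}
    (hM : ∀ x ∈ M, ∀ y ∈ M, ∀ z ∈ M, x ∘L (adjoint y ∘L z) ∈ M)
    (hone : ContinuousLinearMap.id ℂ F ∈
      (Submodule.span ℂ {x | ∃ m ∈ M, ∃ b : F →L[ℂ] E, x = m ∘L b}).topologicalClosure) :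
    ContinuousLinearMap.id ℂ F ∈
      (Submodule.span ℂ {x | ∃ m ∈ M, ∃ n ∈ M, x = m ∘L adjoint n}).topologicalClosure := by
  obtain ⟨t, ht, hdist⟩ := Metric.mem_closure_iff.mp hone (1 / 2) (by norm_num)
  obtain ⟨a, ha, C, hC, hbd⟩ := exists_norm_adjoint_sq_le_of_mem_span ht
  have hcoer : ∀ x, 1 / (4 * (C + 1)) * ‖x‖ ^ 2 ≤ (inner ℂ (a x) x).re := by
    intro x
    obtain ⟨h₁, h₂⟩ := hbd x
    have hlow : ‖x‖ / 2 ≤ ‖adjoint t x‖ := by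
      have h₃ : ‖x - adjoint t x‖ ≤ 1 / 2 * ‖x‖ := by
        have h₄ : x - adjoint t x = adjoint (ContinuousLinearMap.id ℂ F - t) x := by
          simp [map_sub, ← one_def, ← star_eq_adjoint]
        rw [h₄]
        refine (le_opNorm _ _).trans ?_
        rw [LinearIsometryEquiv.norm_map, ← dist_eq_norm]
        gcongr
      have := norm_sub_norm_le x (adjoint t x)
      linarith
    have hsq := pow_le_pow_left₀ (by positivity) hlow 2
    rw [one_div, inv_mul_le_iff₀ (by positivity)]
    nlinarith
  obtain ⟨c, hc⟩ := exists_norm_one_sub_smul_lt_one (by positivity) hcoer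
  set A := Submodule.span ℂ {x : F →L[ℂ] F | ∃ m ∈ M, ∃ n ∈ M, x = m ∘L adjoint n}
  have hca : c • a ∈ A := A.smul_mem c ha
  have hmem : ∀ n : ℕ, 1 - (1 - c • a) ^ n ∈ A := by
    intro n
    induction n with
    | zero => simp
    | succ n ih =>
      have : 1 - (1 - c • a) ^ (n + 1) =
          (1 - (1 - c • a) ^ n) + (c • a - (1 - (1 - c • a) ^ n) * (c • a)) := by
        generalize c • a = b
        rw [pow_succ]
        noncomm_ring
      rw [this]
      exact add_mem ih (sub_mem hca (span_comp_adjoint_mul_mem hM ih hca))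
  have hlim := (tendsto_pow_atTop_nhds_zero_of_norm_lt_one hc).const_sub 1
  rw [sub_zero] at hlim
  exact mem_closure_of_tendsto hlim (Filter.Eventually.of_forall hmem)

end TernaryRing

/-- if `S ⊆ B(H)`, `T ⊆ B(K)` are concrete operator systems (norm-closed
self-adjoint unital subspaces) and `M` is a TRO with `T` the norm-closed span of `M S M*`
and `S` the norm-closed span of `M* T M`, then `I_H` lies in the norm-closed span of
`M*M` and `I_K` lies in the norm-closed span of `M M*`. -/
theorem stmt_14 {H K : Type*}
    [NormedAddCommGroup H] [InnerProductSpace ℂ H] [CompleteSpace H]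
    [NormedAddCommGroup K] [InnerProductSpace ℂ K] [CompleteSpace K]
    (S : Submodule ℂ (H →L[ℂ] H)) (hSclosed : IsClosed (S : Set (H →L[ℂ] H)))
    (hSsa : ∀ s ∈ S, adjoint s ∈ S) (hSone : ContinuousLinearMap.id ℂ H ∈ S)
    (T : Submodule ℂ (K →L[ℂ] K)) (hTclosed : IsClosed (T : Set (K →L[ℂ] K)))
    (hTsa : ∀ t ∈ T, adjoint t ∈ T) (hTone : ContinuousLinearMap.id ℂ K ∈ T)
    (M : Submodule ℂ (H →L[ℂ] K))
    (hM : ∀ x ∈ M, ∀ y ∈ M, ∀ z ∈ M, x ∘L (adjoint y ∘L z) ∈ M)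
    (hT : T = (Submodule.span ℂ
      {x | ∃ m ∈ M, ∃ n ∈ M, ∃ s ∈ S, x = (m ∘L s) ∘L adjoint n}).topologicalClosure)
    (hS : S = (Submodule.span ℂ
      {x | ∃ m ∈ M, ∃ n ∈ M, ∃ t ∈ T, x = (adjoint m ∘L t) ∘L n}).topologicalClosure) :
    ContinuousLinearMap.id ℂ H ∈
      (Submodule.span ℂ {x | ∃ m ∈ M, ∃ n ∈ M, x = adjoint m ∘L n}).topologicalClosure ∧
    ContinuousLinearMap.id ℂ K ∈
      (Submodule.span ℂ {x | ∃ m ∈ M, ∃ n ∈ M, x = m ∘L adjoint n}).topologicalClosure := by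
  constructor
  · have hM' : ∀ x ∈ adjoint '' (M : Set (H →L[ℂ] K)), ∀ y ∈ adjoint '' (M : Set (H →L[ℂ] K)),
        ∀ z ∈ adjoint '' (M : Set (H →L[ℂ] K)),
        x ∘L (adjoint y ∘L z) ∈ adjoint '' (M : Set (H →L[ℂ] K)) := by
      rintro _ ⟨x, hx, rfl⟩ _ ⟨y, hy, rfl⟩ _ ⟨z, hz, rfl⟩
      refine ⟨_, hM z hz y hy x hx, ?_⟩
      simp only [adjoint_comp, adjoint_adjoint, comp_assoc]
    rw [hS] at hSone
    have h := id_mem_closure_span_comp_adjoint hM'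
      (Submodule.topologicalClosure_mono (Submodule.span_mono ?_) hSone)
    · refine Submodule.topologicalClosure_mono (Submodule.span_mono ?_) h
      rintro _ ⟨_, ⟨m, hm, rfl⟩, _, ⟨n, hn, rfl⟩, rfl⟩
      exact ⟨m, hm, n, hn, by rw [adjoint_adjoint]⟩
    · rintro _ ⟨m, hm, n, -, t, -, rfl⟩
      exact ⟨adjoint m, ⟨m, hm, rfl⟩, t ∘L n, rfl⟩
  · rw [hT] at hTone
    refine id_mem_closure_span_comp_adjoint (M := (M : Set (H →L[ℂ] K))) hM
      (Submodule.topologicalClosure_mono (Submodule.span_mono ?_) hTone)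
    rintro _ ⟨m, hm, n, -, s, -, rfl⟩
    exact ⟨m, hm, s ∘L adjoint n, rfl⟩
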